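/- For any integer g ≥ 2: ∑_{i=-(2g-3)}^{2g-3} ⌈(2g-3-|i|)/2⌉ q^{2g-3+i} = q(1-q^{2g-3})(1-q^{2g-2}) / ((1-q)(1-q^2)); equivalently, (1-q)(1-q^2) · ∑_{i=-(2g-3)}^{2g-3} ⌈(2g-3-|i|)/2⌉ q^{2g-3+i} = q(1-q^{2g-3})(1-q^{2g-2}). -/

import Mathlib

lemma auxA (q : ℚ) (M : ℕ) :
    (1 - q) * (1 - q ^ 2) * ∑ k ∈ Finset.range (2 * M), (((k + 1) / 2 : ℕ) : ℚ) * q ^ k =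
      q - q ^ (2 * M) * ((M + (M + 1) * q) * (1 - q) + q ^ 2) := by
  induction M with
  | zero => simp; ring
  | succ M ih =>
    rw [show 2 * (M + 1) = 2 * M + 1 + 1 by ring, Finset.sum_range_succ, Finset.sum_range_succ,
      show (2 * M + 1) / 2 = M by omega, show (2 * M + 1 + 1) / 2 = M + 1 by omega,
      mul_add, mul_add, ih]
    push_cast
    ring

lemma auxB (q N : ℚ) (M : ℕ) :
    (1 - q) * (1 - q ^ 2) * ∑ k ∈ Finset.range (2 * M), (N - ((k / 2 : ℕ) : ℚ)) * q ^ k =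
      (1 - q ^ 2) * (N - (N - M) * q ^ (2 * M)) - q ^ 2 * (1 - q ^ (2 * M)) := by
  induction M with
  | zero => simp
  | succ M ih =>
    rw [show 2 * (M + 1) = 2 * M + 1 + 1 by ring, Finset.sum_range_succ, Finset.sum_range_succ,
      show (2 * M + 1) / 2 = M by omega, show (2 * M) / 2 = M by omega,
      mul_add, mul_add, ih]
    push_cast
    ring

lemma auxC (a b : ℤ) (x : ℚ) (hx : x = a) (h : a = 2 * b ∨ a = 2 * b - 1) : ⌈x / 2⌉ = b := by
  rw [Int.ceil_eq_iff, hx]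
  rcases h with h | h <;> subst h <;> push_cast <;> constructor <;> linarith

theorem stmt14 (g : ℕ) (hg : 2 ≤ g) (q : ℚ) :
    (1 - q) * (1 - q ^ 2) *
        ∑ i ∈ Finset.Icc (-(2 * (g : ℤ) - 3)) (2 * (g : ℤ) - 3),
          ((⌈(2 * (g : ℚ) - 3 - |(i : ℚ)|) / 2⌉ : ℤ) : ℚ) * q ^ (2 * (g : ℤ) - 3 + i).toNat =
      q * (1 - q ^ (2 * g - 3)) * (1 - q ^ (2 * g - 2)) := by
  obtain ⟨m, rfl⟩ := Nat.exists_eq_add_of_le hg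
  have h1 : ∑ i ∈ Finset.Icc (-(2 * ((2 + m : ℕ) : ℤ) - 3)) (2 * ((2 + m : ℕ) : ℤ) - 3),
          ((⌈(2 * ((2 + m : ℕ) : ℚ) - 3 - |(i : ℚ)|) / 2⌉ : ℤ) : ℚ) *
            q ^ (2 * ((2 + m : ℕ) : ℤ) - 3 + i).toNat =
      ∑ k ∈ Finset.range (2 * (m + 1) + (2 * m + 1)),
        ((⌈(2 * ((2 + m : ℕ) : ℚ) - 3 - |(((k : ℤ) - (2 * m + 1) : ℤ) : ℚ)|) / 2⌉ : ℤ) : ℚ)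
          * q ^ k := by
    refine Finset.sum_nbij' (fun i => (2 * ((2 + m : ℕ) : ℤ) - 3 + i).toNat)
      (fun k => (k : ℤ) - (2 * m + 1)) ?_ ?_ ?_ ?_ ?_
    · intro i hi
      simp only [Finset.mem_Icc, Finset.mem_range] at *
      omega
    · intro i hi
      simp only [Finset.mem_Icc, Finset.mem_range] at *
      omega
    · intro i hi
      simp only [Finset.mem_Icc] at *
      omega
    · intro i hi
      simp only [Finset.mem_range] at *
      omega
    · intro i hi
      simp only [Finset.mem_Icc] at *
      rw [show (((2 * ((2 + m : ℕ) : ℤ) - 3 + i).toNat : ℤ) - (2 * m + 1)) = i by omega]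
  have hA : ∀ k ∈ Finset.range (2 * (m + 1)),
      ((⌈(2 * ((2 + m : ℕ) : ℚ) - 3 - |(((k : ℤ) - (2 * m + 1) : ℤ) : ℚ)|) / 2⌉ : ℤ) : ℚ)
          * q ^ k = (((k + 1) / 2 : ℕ) : ℚ) * q ^ k := by
    intro k hk
    rw [Finset.mem_range] at hk
    rw [auxC (k : ℤ) (((k + 1) / 2 : ℕ) : ℤ) _ ?_ (by omega)]
    · rw [Int.cast_natCast]
    · rw [← Int.cast_abs, abs_of_nonpos (by omega)]
      push_cast
      ring
  have hB : ∀ k ∈ Finset.range (2 * m + 1),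
      ((⌈(2 * ((2 + m : ℕ) : ℚ) - 3 -
        |((((2 * (m + 1) + k : ℕ) : ℤ) - (2 * m + 1) : ℤ) : ℚ)|) / 2⌉ : ℤ) : ℚ)
          * q ^ (2 * (m + 1) + k) =
        q ^ (2 * (m + 1)) * (((m : ℚ) - ((k / 2 : ℕ) : ℚ)) * q ^ k) := by
    intro k hk
    rw [Finset.mem_range] at hk
    rw [auxC (2 * m - k : ℤ) (m - ((k / 2 : ℕ) : ℤ)) _ ?_ (by omega)]
    · rw [pow_add]
      simp only [Int.cast_sub, Int.cast_natCast]
      ring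
    · rw [← Int.cast_abs, abs_of_nonneg (by omega)]
      push_cast
      ring
  rw [h1, Finset.sum_range_add, Finset.sum_congr rfl hA, Finset.sum_congr rfl hB,
    ← Finset.mul_sum, mul_add, auxA, Finset.sum_range_succ, mul_left_comm, mul_add ((1 - q) * (1 - q ^ 2)), auxB,
    show 2 * m / 2 = m by omega, show 2 * (2 + m) - 3 = 2 * m + 1 by omega,
    show 2 * (2 + m) - 2 = 2 * m + 2 by omega]
  push_cast
  ring
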